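/- arXiv:2408.03459 — 2 statements merged into one kernel-verified Lean document; each statement's English description precedes it below -/
import Mathlib

section
/- There exists an absolute constant c₀ > 0 such that for every integer d ≥ 2 and all reals v > 0, ε > 0 and l_b ∈ [0, 1] the following holds. Let (α, α') be distributed according to γ_v^d ⊗ γ_v^d (two independent vectors with i.i.d. N(0, v²) coordinates) and set x = l_b·e₁ + e₂ + α and x' = l_b·e₁ − e₂ + α'. Then the probability that |⟨x, x'⟩ − (l_b² − 1)| > 2εv is at most 2·exp(−ε²/16) + 2·exp(−c₀·(ε/v)·min(1, ε/(dv))). -/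
open MeasureTheory ProbabilityTheory Real
open scoped ENNReal NNReal

lemma lintegral_pi_prod_eq_prod {ι : Type*} [Fintype ι] (μ : Measure ℝ) [IsProbabilityMeasure μ]
    (f : ι → ℝ → ℝ≥0∞) (hf : ∀ i, Measurable (f i)) :
    ∫⁻ x, ∏ i, f i (x i) ∂(Measure.pi fun _ : ι => μ) = ∏ i, ∫⁻ y, f i y ∂μ := by
  have hind : iIndepFun (fun i (x : ι → ℝ) => f i (x i)) (Measure.pi fun _ : ι => μ) :=
    iIndepFun_pi fun i => (hf i).aemeasurable
  rw [lintegral_prod_eq_prod_lintegral_of_indepFun Finset.univ _ hind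
    fun i => (hf i).comp (measurable_pi_apply i)]
  refine Finset.prod_congr rfl fun i _ => ?_
  exact (measurePreserving_eval (fun _ : ι => μ) i).lintegral_comp (hf i)

lemma lintegral_exp_mul_gaussianReal (w : ℝ≥0) (a : ℝ) :
    ∫⁻ x, ENNReal.ofReal (exp (a * x)) ∂gaussianReal 0 w = ENNReal.ofReal (exp (w * a ^ 2 / 2)) := by
  rw [← ofReal_integral_eq_lintegral_ofReal (integrable_exp_mul_gaussianReal a)
    (ae_of_all _ fun x => (exp_pos _).le)]
  have h := congrFun (mgf_fun_id_gaussianReal (μ := 0) (v := w)) a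
  simp only [mgf] at h
  rw [h]
  simp

lemma lintegral_exp_sum_mul_gaussianReal {ι : Type*} [Fintype ι] (w : ℝ≥0) (a : ι → ℝ) :
    ∫⁻ x, ENNReal.ofReal (exp (∑ i, a i * x i)) ∂(Measure.pi fun _ : ι => gaussianReal 0 w)
      = ENNReal.ofReal (exp (w / 2 * ∑ i, a i ^ 2)) := by
  simp_rw [exp_sum, ENNReal.ofReal_prod_of_nonneg fun _ _ => (exp_pos _).le]
  rw [lintegral_pi_prod_eq_prod (gaussianReal 0 w) (fun i y => ENNReal.ofReal (exp (a i * y)))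
    fun i => by fun_prop]
  simp_rw [lintegral_exp_mul_gaussianReal]
  rw [← ENNReal.ofReal_prod_of_nonneg fun _ _ => (exp_pos _).le, ← exp_sum, Finset.mul_sum]
  congr 3 with i
  ring

lemma lintegral_exp_mul_sq_gaussianReal_le {w : ℝ≥0} (hw : w ≠ 0) {b : ℝ} (hb : 0 ≤ b)
    (hbw : 2 * b * w ≤ 1 / 2) :
    ∫⁻ x, ENNReal.ofReal (exp (b * x ^ 2)) ∂gaussianReal 0 w
      ≤ ENNReal.ofReal (exp (2 * b * w)) := by
  have hw0 : (0 : ℝ) < w := by positivity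
  set s : ℝ := 2 * b * w with hs
  have hs0 : 0 ≤ s := by positivity
  have h1s : 0 < 1 - s := by linarith
  set w' : ℝ≥0 := w / (1 - s).toNNReal with hw'
  have hcoe : (w' : ℝ) = w / (1 - s) := by
    rw [hw', NNReal.coe_div, Real.coe_toNNReal _ h1s.le]
  have hwne : w' ≠ 0 := by
    have : (0 : ℝ) < w' := by rw [hcoe]; positivity
    exact_mod_cast this.ne'
  have hpdf : ∀ x, gaussianPDF 0 w x * ENNReal.ofReal (exp (b * x ^ 2))
      = ENNReal.ofReal (√(1 - s))⁻¹ * gaussianPDF 0 w' x := fun x => by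
    rw [gaussianPDF, gaussianPDF, ← ENNReal.ofReal_mul (gaussianPDFReal_nonneg _ _ _),
      ← ENNReal.ofReal_mul (by positivity), gaussianPDFReal, gaussianPDFReal, mul_assoc, ← exp_add,
      hcoe, mul_div_assoc', Real.sqrt_div (by positivity)]
    have hq : √(1 - s) ≠ 0 := by positivity
    have hq' : √(2 * π * w) ≠ 0 := by positivity
    have he : -(x - 0) ^ 2 / (2 * (w : ℝ)) + b * x ^ 2 = -(x - 0) ^ 2 / (2 * (w / (1 - s))) := by
      have : (w : ℝ) ≠ 0 := hw0.ne'
      field_simp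
      rw [hs]
      ring
    rw [he]
    congr 1
    field_simp
  rw [gaussianReal_of_var_ne_zero _ hw,
    lintegral_withDensity_eq_lintegral_mul _ (measurable_gaussianPDF 0 w) (by fun_prop)]
  simp only [Pi.mul_apply, hpdf]
  rw [lintegral_const_mul _ (measurable_gaussianPDF 0 w'), lintegral_gaussianPDF_eq_one _ hwne,
    mul_one]
  refine ENNReal.ofReal_le_ofReal (inv_le_of_inv_le₀ (exp_pos _) ?_)
  rw [← exp_neg]
  refine Real.le_sqrt_of_sq_le ?_
  rw [← exp_nat_mul]
  have h2 : 1 + 2 * s ≤ exp (2 * s) := by linarith [add_one_le_exp (2 * s)]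
  have h3 : exp (((2 : ℕ) : ℝ) * -s) * exp (2 * s) = 1 := by
    rw [← exp_add]; simp
  nlinarith [exp_pos (((2 : ℕ) : ℝ) * -s), mul_nonneg hs0 (sub_nonneg.2 hbw)]

lemma lintegral_exp_dot_gaussianReal_le (d : ℕ) {w : ℝ≥0} (hw : w ≠ 0) {t : ℝ}
    (ht : (t * w) ^ 2 ≤ 1 / 2) :
    ∫⁻ p : (Fin d → ℝ) × (Fin d → ℝ), ENNReal.ofReal (exp (t * ∑ m, p.1 m * p.2 m))
        ∂((Measure.pi fun _ : Fin d => gaussianReal 0 w).prod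
          (Measure.pi fun _ : Fin d => gaussianReal 0 w))
      ≤ ENNReal.ofReal (exp (d * (t * w) ^ 2)) := by
  rw [lintegral_prod _ (by fun_prop)]
  have hin : ∀ x : Fin d → ℝ, ∫⁻ y, ENNReal.ofReal (exp (t * ∑ m, x m * y m))
        ∂(Measure.pi fun _ : Fin d => gaussianReal 0 w)
      = ∏ m, ENNReal.ofReal (exp (w / 2 * t ^ 2 * x m ^ 2)) := fun x => by
    have h := lintegral_exp_sum_mul_gaussianReal w fun m => t * x m
    simp_rw [mul_assoc t, ← Finset.mul_sum] at h
    rw [h, ← ENNReal.ofReal_prod_of_nonneg fun _ _ => (exp_pos _).le, ← exp_sum, Finset.mul_sum]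
    congr 3 with m
    ring
  simp_rw [hin]
  rw [lintegral_pi_prod_eq_prod (gaussianReal 0 w)
    (fun _ y => ENNReal.ofReal (exp (w / 2 * t ^ 2 * y ^ 2))) fun i => by fun_prop]
  have hb : 2 * (w / 2 * t ^ 2) * w = (t * w) ^ 2 := by ring
  calc ∏ _m : Fin d, ∫⁻ y, ENNReal.ofReal (exp (w / 2 * t ^ 2 * y ^ 2)) ∂gaussianReal 0 w
      ≤ ∏ _m : Fin d, ENNReal.ofReal (exp (2 * (w / 2 * t ^ 2) * w)) :=
        Finset.prod_le_prod' fun m _ =>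
          lintegral_exp_mul_sq_gaussianReal_le hw (by positivity) (hb ▸ ht)
    _ = ENNReal.ofReal (exp (d * (t * w) ^ 2)) := by
        rw [← ENNReal.ofReal_prod_of_nonneg fun _ _ => (exp_pos _).le, ← exp_sum, hb]
        simp

lemma lintegral_exp_linear_gaussianReal (d : ℕ) (w : ℝ≥0) (a b : Fin d → ℝ) (t : ℝ) :
    ∫⁻ p : (Fin d → ℝ) × (Fin d → ℝ),
        ENNReal.ofReal (exp (t * (∑ m, a m * p.1 m + ∑ m, b m * p.2 m)))
        ∂((Measure.pi fun _ : Fin d => gaussianReal 0 w).prod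
          (Measure.pi fun _ : Fin d => gaussianReal 0 w))
      = ENNReal.ofReal (exp (w / 2 * t ^ 2 * (∑ m, a m ^ 2 + ∑ m, b m ^ 2))) := by
  have ha := lintegral_exp_sum_mul_gaussianReal w fun m => t * a m
  have hb := lintegral_exp_sum_mul_gaussianReal w fun m => t * b m
  simp_rw [mul_assoc t, mul_pow, ← Finset.mul_sum] at ha hb
  simp_rw [mul_add, exp_add, ENNReal.ofReal_mul (exp_pos _).le]
  rw [lintegral_prod_mul (f := fun x : Fin d → ℝ => ENNReal.ofReal (exp (t * ∑ m, a m * x m)))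
    (g := fun y : Fin d → ℝ => ENNReal.ofReal (exp (t * ∑ m, b m * y m)))
    (Measurable.aemeasurable (by fun_prop)) (Measurable.aemeasurable (by fun_prop)), ha, hb,
    mul_assoc, mul_assoc]

/-- One-sided Chernoff bound. -/
lemma measure_lt_le_of_lintegral_exp_le {Ω : Type*} [MeasurableSpace Ω] {μ : Measure Ω}
    {X : Ω → ℝ} (hX : Measurable X) {t a K : ℝ} (ht : 0 ≤ t)
    (h : ∫⁻ ω, ENNReal.ofReal (exp (t * X ω)) ∂μ ≤ ENNReal.ofReal (exp K)) :
    μ {ω | a < X ω} ≤ ENNReal.ofReal (exp (K - t * a)) := by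
  calc μ {ω | a < X ω}
      ≤ μ {ω | ENNReal.ofReal (exp (t * a)) ≤ ENNReal.ofReal (exp (t * X ω))} := by
        refine measure_mono fun ω (hω : a < X ω) => ?_
        exact ENNReal.ofReal_le_ofReal (exp_le_exp.2 (mul_le_mul_of_nonneg_left hω.le ht))
    _ ≤ (∫⁻ ω, ENNReal.ofReal (exp (t * X ω)) ∂μ) / ENNReal.ofReal (exp (t * a)) :=
        meas_ge_le_lintegral_div (by fun_prop) (by simp [exp_pos]) ENNReal.ofReal_ne_top
    _ ≤ ENNReal.ofReal (exp K) / ENNReal.ofReal (exp (t * a)) := by gcongr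
    _ = ENNReal.ofReal (exp (K - t * a)) := by
        rw [← ENNReal.ofReal_div_of_pos (exp_pos _), exp_sub]

/-- Two-sided Chernoff bound. -/
lemma measure_lt_abs_le_of_lintegral_exp_le {Ω : Type*} [MeasurableSpace Ω] {μ : Measure Ω}
    {X : Ω → ℝ} (hX : Measurable X) {t a K : ℝ} (ht : 0 ≤ t)
    (h : ∫⁻ ω, ENNReal.ofReal (exp (t * X ω)) ∂μ ≤ ENNReal.ofReal (exp K))
    (h' : ∫⁻ ω, ENNReal.ofReal (exp (-t * X ω)) ∂μ ≤ ENNReal.ofReal (exp K)) :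
    μ {ω | a < |X ω|} ≤ ENNReal.ofReal (2 * exp (K - t * a)) := by
  have hneg := measure_lt_le_of_lintegral_exp_le (a := a) hX.neg ht
    (by simpa only [Pi.neg_apply, mul_neg, neg_mul] using h')
  calc μ {ω | a < |X ω|} ≤ μ ({ω | a < X ω} ∪ {ω | a < (-X) ω}) :=
        measure_mono fun ω (hω : a < |X ω|) => lt_abs.1 hω
    _ ≤ μ {ω | a < X ω} + μ {ω | a < (-X) ω} := measure_union_le _ _
    _ ≤ ENNReal.ofReal (exp (K - t * a)) + ENNReal.ofReal (exp (K - t * a)) :=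
        add_le_add (measure_lt_le_of_lintegral_exp_le hX ht h) hneg
    _ = ENNReal.ofReal (2 * exp (K - t * a)) := by
        rw [← ENNReal.ofReal_add (exp_pos _).le (exp_pos _).le, two_mul]

lemma measure_linear_gaussianReal_le (d : ℕ) {v ε : ℝ} (hv : 0 < v) (hε : 0 < ε)
    {a b : Fin d → ℝ} (ha : ∑ m, a m ^ 2 ≤ 2) (hb : ∑ m, b m ^ 2 ≤ 2) :
    ((Measure.pi fun _ : Fin d => gaussianReal 0 (v.toNNReal ^ 2)).prod
        (Measure.pi fun _ : Fin d => gaussianReal 0 (v.toNNReal ^ 2)))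
      {p | ε * v < |∑ m, a m * p.1 m + ∑ m, b m * p.2 m|}
      ≤ ENNReal.ofReal (2 * exp (-ε ^ 2 / 8)) := by
  have hw : ((v.toNNReal ^ 2 : ℝ≥0) : ℝ) = v ^ 2 := by
    rw [NNReal.coe_pow, Real.coe_toNNReal _ hv.le]
  have hmgf : ∀ t : ℝ, t ^ 2 = (ε / (4 * v)) ^ 2 → _ :=
    fun t ht => (lintegral_exp_linear_gaussianReal d (v.toNNReal ^ 2) a b t).le.trans
      (c := ENNReal.ofReal (exp (ε ^ 2 / 8))) <| by
        refine ENNReal.ofReal_le_ofReal (exp_le_exp.2 ?_)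
        have : v ^ 2 / 2 * (ε / (4 * v)) ^ 2 = ε ^ 2 / 32 := by field_simp; norm_num
        rw [hw, ht, this]
        nlinarith [sq_nonneg ε]
  convert measure_lt_abs_le_of_lintegral_exp_le (a := ε * v) (t := ε / (4 * v)) (by fun_prop)
    (by positivity) (hmgf _ rfl) (hmgf _ (neg_sq _)) using 4
  field_simp
  ring

lemma measure_dot_gaussianReal_le {d : ℕ} (hd : 0 < d) {v ε : ℝ} (hv : 0 < v) (hε : 0 < ε) :
    ((Measure.pi fun _ : Fin d => gaussianReal 0 (v.toNNReal ^ 2)).prod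
        (Measure.pi fun _ : Fin d => gaussianReal 0 (v.toNNReal ^ 2)))
      {p | ε * v < |∑ m, p.1 m * p.2 m|}
      ≤ ENNReal.ofReal (2 * exp (-(1 / 4) * (ε / v) * min 1 (ε / (d * v)))) := by
  have hw : ((v.toNNReal ^ 2 : ℝ≥0) : ℝ) = v ^ 2 := by
    rw [NNReal.coe_pow, Real.coe_toNNReal _ hv.le]
  have hw0 : v.toNNReal ^ 2 ≠ 0 := by simpa using hv
  have hd' : (0 : ℝ) < d := by exact_mod_cast hd
  set r : ℝ := min 1 (ε / (d * v))
  have hr0 : 0 < r := lt_min one_pos (by positivity)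
  have hr1 : r ≤ 1 := min_le_left _ _
  have hr2 : d * r ≤ ε / v := by
    calc d * r ≤ d * (ε / (d * v)) := by gcongr; exact min_le_right _ _
      _ = ε / v := by field_simp
  have hmgf : ∀ t : ℝ, (t * v ^ 2) ^ 2 = (r / 2) ^ 2 → _ := fun t ht =>
    (lintegral_exp_dot_gaussianReal_le d hw0 (t := t) (by rw [hw, ht]; nlinarith))
  have htr : r / 2 / v ^ 2 * v ^ 2 = r / 2 := by field_simp
  have hp := hmgf (r / 2 / v ^ 2) (by rw [htr])
  have hm := hmgf (-(r / 2 / v ^ 2)) (by rw [neg_mul, htr, neg_sq])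
  rw [hw, htr] at hp
  rw [hw, neg_mul, htr, neg_sq] at hm
  refine (measure_lt_abs_le_of_lintegral_exp_le (a := ε * v) (by fun_prop)
    (by positivity) hp hm).trans (ENNReal.ofReal_le_ofReal ?_)
  have h : r / 2 / v ^ 2 * (ε * v) = r / 2 * (ε / v) := by field_simp
  rw [h]
  gcongr
  nlinarith

/-- Concentration of the inner product of two independent samples
`x = l_b·e₁ + e₂ + α`, `x' = l_b·e₁ − e₂ + α'` from opposite clusters of the same
concept pair, with Gaussian noises `α, α' ~ N(0, v²I_d)`: with the stated probability
bound, `|⟨x, x'⟩ − (l_b² − 1)| ≤ 2εv`. -/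
theorem opposite_cluster_inner_concentration :
    ∃ c₀ : ℝ, 0 < c₀ ∧
      ∀ (d : ℕ) (hd : 2 ≤ d) (v ε lb : ℝ), 0 < v → 0 < ε → 0 ≤ lb → lb ≤ 1 →
        ((Measure.pi fun _ : Fin d => gaussianReal 0 (v.toNNReal ^ 2)).prod
            (Measure.pi fun _ : Fin d => gaussianReal 0 (v.toNNReal ^ 2)))
          {p : (Fin d → ℝ) × (Fin d → ℝ) |
            2 * ε * v <
              |(∑ m, ((lb • (Pi.single (⟨0, by omega⟩ : Fin d) (1 : ℝ) : Fin d → ℝ)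
                    + (Pi.single (⟨1, by omega⟩ : Fin d) (1 : ℝ) : Fin d → ℝ) + p.1) m)
                  * ((lb • (Pi.single (⟨0, by omega⟩ : Fin d) (1 : ℝ) : Fin d → ℝ)
                    - (Pi.single (⟨1, by omega⟩ : Fin d) (1 : ℝ) : Fin d → ℝ) + p.2) m))
                - (lb ^ 2 - 1)|}
          ≤ ENNReal.ofReal
              (2 * exp (-ε ^ 2 / 16) + 2 * exp (-c₀ * (ε / v) * min 1 (ε / (d * v)))) := by
  refine ⟨1 / 4, by norm_num, fun d hd v ε lb hv hε hl0 hl1 => ?_⟩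
  set i : Fin d := ⟨0, by omega⟩
  set j : Fin d := ⟨1, by omega⟩
  have hij : i ≠ j := by simp [i, j]
  set u : Fin d → ℝ := lb • (Pi.single i (1 : ℝ) : Fin d → ℝ) + (Pi.single j (1 : ℝ) : Fin d → ℝ)
  set u' : Fin d → ℝ := lb • (Pi.single i (1 : ℝ) : Fin d → ℝ) - (Pi.single j (1 : ℝ) : Fin d → ℝ)
  have hlb : lb ^ 2 ≤ 1 := by nlinarith
  have hsq : ∀ c : ℝ, ∀ m, (lb * (Pi.single i (1 : ℝ) : Fin d → ℝ) m
        + c * (Pi.single j (1 : ℝ) : Fin d → ℝ) m) ^ 2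
      = (Pi.single i (lb ^ 2) : Fin d → ℝ) m + (Pi.single j (c ^ 2) : Fin d → ℝ) m := fun c m => by
    by_cases hi : m = i
    · subst hi; simp [hij]
    · by_cases hj : m = j
      · subst hj; simp [hi]
      · simp [hi, hj]
  have hu : ∑ m, u m ^ 2 ≤ 2 := by
    have : ∀ m, u m ^ 2 = _ := fun m => by simpa [u] using hsq 1 m
    simp_rw [this, Finset.sum_add_distrib, Finset.sum_pi_single', Finset.mem_univ, if_true]
    linarith
  have hu' : ∑ m, u' m ^ 2 ≤ 2 := by
    have : ∀ m, u' m ^ 2 = _ := fun m => by simpa [u', sub_eq_add_neg] using hsq (-1) m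
    simp_rw [this, Finset.sum_add_distrib, Finset.sum_pi_single', Finset.mem_univ, if_true]
    linarith
  have huu' : ∑ m, u m * u' m = lb ^ 2 - 1 := by
    have : ∀ m, u m * u' m
        = (Pi.single i (lb ^ 2) : Fin d → ℝ) m - (Pi.single j 1 : Fin d → ℝ) m := fun m => by
      by_cases hi : m = i
      · subst hi; simp [u, u', hij, sq]
      · by_cases hj : m = j
        · subst hj; simp [u, u', hi]
        · simp [u, u', hi, hj]
    simp_rw [this, Finset.sum_sub_distrib, Finset.sum_pi_single', Finset.mem_univ, if_true]
  have hexpand : ∀ p : (Fin d → ℝ) × (Fin d → ℝ),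
      ∑ m, (u + p.1) m * (u' + p.2) m - (lb ^ 2 - 1)
        = (∑ m, u' m * p.1 m + ∑ m, u m * p.2 m) + ∑ m, p.1 m * p.2 m := fun p => by
    rw [← huu', ← Finset.sum_sub_distrib, ← Finset.sum_add_distrib, ← Finset.sum_add_distrib]
    refine Finset.sum_congr rfl fun m _ => ?_
    simp only [Pi.add_apply]
    ring
  rw [ENNReal.ofReal_add (by positivity) (by positivity)]
  refine (measure_mono ?_).trans ((measure_union_le _ _).trans (add_le_add
    ((measure_linear_gaussianReal_le d hv hε hu' hu).trans ?_)
    (measure_dot_gaussianReal_le (by omega) hv hε)))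
  · intro p hp
    simp only [Set.mem_ofPred_eq, hexpand] at hp
    by_contra hcon
    simp only [Set.mem_union, Set.mem_ofPred_eq, not_or, not_lt] at hcon
    linarith [abs_add_le (∑ m, u' m * p.1 m + ∑ m, u m * p.2 m) (∑ m, p.1 m * p.2 m)]
  · refine ENNReal.ofReal_le_ofReal ?_
    gcongr 2 * exp ?_
    nlinarith [sq_nonneg ε]
end

section
/- Assume Z·l_b² ≤ 1/4 and ε·v·(Z + 2) ≤ 1/8. Let C be cluster-structured, let (r_j) be a reward trajectory for C, and let r̃ be the new-sample reward associated with a new-sample interaction vector C̃ (relative to some cluster index k̃ and sign s̃). Set τ₁ = N·τ·log 3/(10·Q·β²), and assume in addition that 0 ≤ r_i(t) ≤ log 3 for every sample i and every t ∈ [0, τ₁]. Then τ·r̃'(t) ≥ 3Qβ²/(8N) for every t ∈ [0, τ₁]; consequently r̃(τ₁) ≥ (3/80)·log 3 > 0, i.e., the new sample is classified correctly at time τ₁. -/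
/-- The logistic sigmoid function. -/
noncomputable def sigmoid (x : ℝ) : ℝ := 1 / (1 + Real.exp (-x))

/-- The time horizon `τ₁ = N·τ·log 3/(10·Q·β²)`. -/
noncomputable def tau1 (N Q : ℕ) (τ β : ℝ) : ℝ :=
  N * τ * Real.log 3 / (10 * Q * β ^ 2)

theorem one_fourth_le_sigmoid_neg {x : ℝ} (hx : x ≤ Real.log 3) : 1 / 4 ≤ sigmoid (-x) := by
  have h : Real.exp x ≤ 3 := (Real.le_log_iff_exp_le (by norm_num)).1 hx
  rw [sigmoid, neg_neg]
  exact one_div_le_one_div_of_le (by positivity) (by linarith)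

theorem sigmoid_neg_le_half {x : ℝ} (hx : 0 ≤ x) : sigmoid (-x) ≤ 1 / 2 := by
  have h : 1 ≤ Real.exp x := Real.one_le_exp hx
  rw [sigmoid, neg_neg]
  exact one_div_le_one_div_of_le (by norm_num) (by linarith)

/-- A weight in `[1/4, 1/2]` times a perturbation of a nonnegative number `a`. -/
theorem weight_mul_lower_bound {w c a δ : ℝ} (hw : 1 / 4 ≤ w) (hw' : w ≤ 1 / 2) (ha : 0 ≤ a)
    (hc : |c - a| ≤ δ) : a / 4 - δ / 2 ≤ w * c := by
  have hδ : 0 ≤ δ := (abs_nonneg _).trans hc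
  have h := (abs_le.1 hc).1
  nlinarith [mul_nonneg (sub_nonneg.2 hw) ha, mul_nonneg (sub_nonneg.2 hw') hδ,
    mul_nonneg (show 0 ≤ w by linarith) (show 0 ≤ c - a + δ by linarith)]

/-- Lower bound on the weighted interaction sum when all weights lie in `[1/4, 1/2]`. -/
theorem weighted_interaction_lower_bound {K Q Z : ℕ} {v ε lb : ℝ} (hv : 0 < v) (hε : 0 ≤ ε)
    (hlb0 : 0 ≤ lb) (hlb1 : lb ≤ 1)
    (hZlb : (Z : ℝ) * lb ^ 2 ≤ 1 / 4)
    (hεv : ε * v * ((Z : ℝ) + 2) ≤ 1 / 8)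
    (ktil : Fin K) (stil : Bool)
    (w Ct : (Fin K × Bool × Fin Q) → ℝ)
    (hw : ∀ i, 1 / 4 ≤ w i) (hw' : ∀ i, w i ≤ 1 / 2)
    (ha : ∀ m : Fin Q, |Ct (ktil, stil, m) - 2 * (1 + lb ^ 2)| ≤ 6 * ε * v)
    (hb : ∀ m : Fin Q, |Ct (ktil, !stil, m) - 2 * (1 - lb ^ 2)| ≤ 6 * ε * v)
    (St : Finset (Fin K)) (hkSt : ktil ∉ St) (hcard : St.card ≤ Z)
    (hzero : ∀ (k : Fin K) (s : Bool) (q : Fin Q), k ∉ St → k ≠ ktil → Ct (k, s, q) = 0)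
    (hcross : ∀ (k : Fin K) (s : Bool) (q : Fin Q),
      k ∈ St → |Ct (k, s, q)| ≤ lb ^ 2 + 3 * ε * v) :
    3 * Q / 8 ≤ ∑ i, w i * Ct i := by
  have hlb : lb ^ 2 ≤ 1 := pow_le_one₀ hlb0 hlb1
  have he : 0 ≤ ε * v := by positivity
  have hself : (Q : ℝ) * (1 - 6 * ε * v) ≤
      ∑ s : Bool, ∑ q : Fin Q, w (ktil, s, q) * Ct (ktil, s, q) := by
    have hsplit : ∑ s : Bool, ∑ q : Fin Q, w (ktil, s, q) * Ct (ktil, s, q) =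
        ∑ q : Fin Q, (w (ktil, stil, q) * Ct (ktil, stil, q) +
          w (ktil, !stil, q) * Ct (ktil, !stil, q)) := by
      rw [Finset.sum_add_distrib]
      cases stil <;> simp [add_comm]
    rw [hsplit]
    have h := Finset.card_nsmul_le_sum (Finset.univ : Finset (Fin Q))
      (fun q => w (ktil, stil, q) * Ct (ktil, stil, q) +
          w (ktil, !stil, q) * Ct (ktil, !stil, q)) (1 - 6 * ε * v) (fun q _ => by
        have h₁ := weight_mul_lower_bound (hw (ktil, stil, q)) (hw' _) (by positivity) (ha q)
        have h₂ := weight_mul_lower_bound (hw (ktil, !stil, q)) (hw' _) (by linarith) (hb q)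
        linarith)
    simpa using h
  have hother : ∀ k ∈ St, -((Q : ℝ) * (lb ^ 2 + 3 * ε * v)) ≤
      ∑ s : Bool, ∑ q : Fin Q, w (k, s, q) * Ct (k, s, q) := by
    intro k hk
    have h : ∀ s, (Q : ℝ) * (-((lb ^ 2 + 3 * ε * v) / 2)) ≤
        ∑ q : Fin Q, w (k, s, q) * Ct (k, s, q) := by
      intro s
      have h := Finset.card_nsmul_le_sum (Finset.univ : Finset (Fin Q))
        (fun q => w (k, s, q) * Ct (k, s, q)) (-((lb ^ 2 + 3 * ε * v) / 2)) (fun q _ => by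
          have h₁ := weight_mul_lower_bound (c := Ct (k, s, q)) (hw (k, s, q)) (hw' _) le_rfl
            (by simpa using hcross k s q hk)
          linarith)
      simpa using h
    rw [Fintype.sum_bool]
    linarith [h true, h false]
  have hsum : ∑ i, w i * Ct i =
      ∑ k ∈ insert ktil St, ∑ s : Bool, ∑ q : Fin Q, w (k, s, q) * Ct (k, s, q) := by
    simp only [Fintype.sum_prod_type]
    refine (Finset.sum_subset (Finset.subset_univ _) fun k _ hk => ?_).symm
    rw [Finset.mem_insert, not_or] at hk
    simp [hzero k _ _ hk.2 hk.1]
  have hSt := Finset.card_nsmul_le_sum St _ _ hother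
  rw [nsmul_eq_mul] at hSt
  have hcard' : (St.card : ℝ) * ((Q : ℝ) * (lb ^ 2 + 3 * ε * v)) ≤
      Z * ((Q : ℝ) * (lb ^ 2 + 3 * ε * v)) := by
    gcongr
  have hQ : (0 : ℝ) ≤ Q * (5 / 8 - Z * lb ^ 2 - 3 * (ε * v * (Z + 2))) :=
    mul_nonneg (Nat.cast_nonneg _) (by linarith)
  rw [hsum, Finset.sum_insert hkSt]
  linarith

/-- Deterministic core of the Generalization Error theorem (Theorem 3.2): for a
cluster-structured `C`, a reward trajectory `(r_j)` with margins in `[0, log 3]` on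
`[0, τ₁]`, and a new-sample interaction vector `C̃`, the associated new-sample reward
satisfies `τ·r̃'(t) ≥ 3Qβ²/(8N)` on `[0, τ₁]`, hence `r̃(τ₁) ≥ (3/80)·log 3 > 0`:
the new sample is classified correctly at time `τ₁`. -/
theorem generalization_new_sample_guarantee
    (K Q d Z : ℕ) (hK : 1 ≤ K) (hQ : 1 ≤ Q) (hd : 1 ≤ d)
    (τ β v ε lb : ℝ) (hτ : 0 < τ) (hβ : 0 < β) (hv : 0 < v) (hε : 0 ≤ ε)
    (hlb0 : 0 ≤ lb) (hlb1 : lb ≤ 1)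
    (hZlb : (Z : ℝ) * lb ^ 2 ≤ 1 / 4)
    (hεv : ε * v * ((Z : ℝ) + 2) ≤ 1 / 8)
    (N : ℕ) (hN : N = 2 * K * Q)
    (C : (Fin K × Bool × Fin Q) → (Fin K × Bool × Fin Q) → ℝ)
    (hsymm : ∀ i j, C i j = C j i)
    (hdiag : ∀ j, |C j j - 2 * (1 + lb ^ 2 + d * v ^ 2)| ≤ 4 * ε * v)
    (hsame : ∀ (k : Fin K) (s : Bool) (q q' : Fin Q), q ≠ q' →
      |C (k, s, q) (k, s, q') - 2 * (1 + lb ^ 2)| ≤ 4 * ε * v)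
    (hopp : ∀ (k : Fin K) (s : Bool) (q q' : Fin Q),
      |C (k, s, q) (k, !s, q') - 2 * (1 - lb ^ 2)| ≤ 4 * ε * v)
    (hcross : ∃ S : Fin K → Finset (Fin K), (∀ k, k ∉ S k) ∧ (∀ k, (S k).card ≤ Z) ∧
      ∀ (k k' : Fin K) (s s' : Bool) (q q' : Fin Q), k ≠ k' →
        (k' ∉ S k → C (k, s, q) (k', s', q') = 0) ∧
        (k' ∈ S k → |C (k, s, q) (k', s', q')| ≤ lb ^ 2 + 2 * ε * v))
    (r r' : (Fin K × Bool × Fin Q) → ℝ → ℝ)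
    (hr0 : ∀ j, r j 0 = 0)
    (hderiv : ∀ j t, 0 ≤ t → HasDerivAt (r j) (r' j t) t)
    (hflow : ∀ j t, 0 ≤ t →
      τ * r' j t = (β ^ 2 / (N : ℝ)) * ∑ i, sigmoid (-(r i t)) * C i j)
    (ktil : Fin K) (stil : Bool)
    (Ct : (Fin K × Bool × Fin Q) → ℝ)
    (ha : ∀ m : Fin Q, |Ct (ktil, stil, m) - 2 * (1 + lb ^ 2)| ≤ 6 * ε * v)
    (hb : ∀ m : Fin Q, |Ct (ktil, !stil, m) - 2 * (1 - lb ^ 2)| ≤ 6 * ε * v)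
    (hc : ∃ St : Finset (Fin K), ktil ∉ St ∧ St.card ≤ Z ∧
      ∀ (k : Fin K) (s : Bool) (q : Fin Q),
        (k ∉ St → k ≠ ktil → Ct (k, s, q) = 0) ∧
        (k ∈ St → |Ct (k, s, q)| ≤ lb ^ 2 + 3 * ε * v))
    (rt rt' : ℝ → ℝ)
    (hrt0 : rt 0 = 0)
    (hrtderiv : ∀ t, 0 ≤ t → HasDerivAt rt (rt' t) t)
    (hrtflow : ∀ t, 0 ≤ t →
      τ * rt' t = (β ^ 2 / (N : ℝ)) * ∑ i, sigmoid (-(r i t)) * Ct i)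
    (hmargins : ∀ (i : Fin K × Bool × Fin Q) (t : ℝ), 0 ≤ t → t ≤ tau1 N Q τ β →
      0 ≤ r i t ∧ r i t ≤ Real.log 3) :
    (∀ t : ℝ, 0 ≤ t → t ≤ tau1 N Q τ β → 3 * Q * β ^ 2 / (8 * N) ≤ τ * rt' t)
    ∧ (3 / 80) * Real.log 3 ≤ rt (tau1 N Q τ β)
    ∧ 0 < rt (tau1 N Q τ β) := by
  have hrate : ∀ t : ℝ, 0 ≤ t → t ≤ tau1 N Q τ β → 3 * Q * β ^ 2 / (8 * N) ≤ τ * rt' t := by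
    intro t ht ht'
    obtain ⟨St, hkSt, hcard, hSt⟩ := hc
    have h := weighted_interaction_lower_bound hv hε hlb0 hlb1 hZlb hεv ktil stil
      (fun i => sigmoid (-(r i t))) Ct
      (fun i => one_fourth_le_sigmoid_neg (hmargins i t ht ht').2)
      (fun i => sigmoid_neg_le_half (hmargins i t ht ht').1) ha hb St hkSt hcard
      (fun k s q => (hSt k s q).1) (fun k s q => (hSt k s q).2)
    rw [hrtflow t ht]
    calc 3 * Q * β ^ 2 / (8 * N) = β ^ 2 / N * (3 * Q / 8) := by ring
      _ ≤ _ := by gcongr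
  have hQ' : (0 : ℝ) < Q := by exact_mod_cast hQ
  have hN' : (0 : ℝ) < N := by
    have : 0 < N := by rw [hN]; positivity
    exact_mod_cast this
  have hlog : 0 < Real.log 3 := Real.log_pos (by norm_num)
  have hT : 0 < tau1 N Q τ β := by unfold tau1; positivity
  have hfinal : (3 / 80) * Real.log 3 ≤ rt (tau1 N Q τ β) := by
    obtain ⟨c, hcm, hslope⟩ := exists_hasDerivAt_eq_slope rt rt' hT
      (fun t ht => (hrtderiv t ht.1).continuousAt.continuousWithinAt)
      (fun t ht => hrtderiv t ht.1.le)
    rw [hrt0, sub_zero, sub_zero, eq_div_iff hT.ne'] at hslope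
    calc (3 / 80) * Real.log 3 = 3 * Q * β ^ 2 / (8 * N) * (tau1 N Q τ β / τ) := by
          unfold tau1; field_simp; norm_num
      _ ≤ τ * rt' c * (tau1 N Q τ β / τ) :=
          mul_le_mul_of_nonneg_right (hrate c hcm.1.le hcm.2.le) (by positivity)
      _ = rt (tau1 N Q τ β) := by rw [← hslope]; field_simp
  exact ⟨hrate, hfinal, lt_of_lt_of_le (by positivity) hfinal⟩
end
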